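/- Let $k \geq 1$ and let $Q_k$ be the $k \times k$ integer matrix with $(Q_k)_{1,1} = -1$, $(Q_k)_{i,i} = -2$ for $2 \leq i \leq k$, $(Q_k)_{i,i+1} = (Q_k)_{i+1,i} = -1$, and all other entries $0$. Define $\xi \in \mathbb{Z}^k$ by $\xi_i = 1$ if $k - i$ is even and $\xi_i = 0$ if $k - i$ is odd. Then $\xi$ is a characteristic vector for $Q_k$, i.e. $\xi^T Q_k w \equiv w^T Q_k w \pmod{2}$ for every $w \in \mathbb{Z}^k$, and $\xi^T Q_k \xi = -k$. In particular there exists a characteristic vector $\xi$ for $Q_k$ with $\xi^T Q_k \xi + k \geq 0$. -/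

import Mathlib

open Matrix

/-- The `k × k` symmetric tridiagonal integer matrix with diagonal `(-1, -2, ..., -2)`,
super- and sub-diagonal entries `-1`, and all other entries `0`. -/
def Qmat (k : ℕ) : Matrix (Fin k) (Fin k) ℤ :=
  Matrix.of fun i j =>
    if i = j then (if i.val = 0 then -1 else -2)
    else if i.val + 1 = j.val ∨ j.val + 1 = i.val then -1 else 0

/-- The vector `ξ ∈ ℤ^k` with (in 1-indexed notation) `ξᵢ = 1` if `k - i` is even
and `ξᵢ = 0` if `k - i` is odd.  (Here `j : Fin k` is the 0-indexed version of
`i = j + 1`.) -/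
def xiVec (k : ℕ) : Fin k → ℤ :=
  fun j => if (k - (j.val + 1)) % 2 = 0 then 1 else 0

/-- The `k × k` upper bidiagonal matrix with ones on the diagonal and superdiagonal. -/
def upperBidiagonal (k : ℕ) : Matrix (Fin k) (Fin k) ℤ :=
  Matrix.of fun i j => (if j = i then 1 else 0) + (if i.val + 1 = j.val then 1 else 0)

theorem Qmat_eq_neg_transpose_mul (k : ℕ) :
    Qmat k = -((upperBidiagonal k)ᵀ * upperBidiagonal k) := by
  ext i j
  simp only [Qmat, upperBidiagonal, neg_apply, mul_apply, transpose_apply, of_apply, add_mul,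
    ite_mul, one_mul, zero_mul, Finset.sum_add_distrib, Finset.sum_ite_eq, Finset.mem_univ,
    if_true]
  by_cases hi : i.val = 0
  · have h (l : Fin k) : ¬ l.val + 1 = i.val := by omega
    simp only [h, if_false, Finset.sum_const_zero, Fin.ext_iff]
    grind
  · have h (l : Fin k) : l.val + 1 = i.val ↔ l = ⟨i.val - 1, by omega⟩ := by
      rw [Fin.ext_iff]
      grind
    simp only [h, Finset.sum_ite_eq', Finset.mem_univ, if_true]
    simp only [Fin.ext_iff]
    grind

theorem upperBidiagonal_mulVec_xiVec (k : ℕ) : upperBidiagonal k *ᵥ xiVec k = 1 := by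
  ext i
  simp only [upperBidiagonal, mulVec, dotProduct, of_apply, add_mul, ite_mul, one_mul, zero_mul,
    Finset.sum_add_distrib, Finset.sum_ite_eq', Finset.mem_univ, if_true, Pi.one_apply]
  by_cases hi : i.val + 1 < k
  · have h (l : Fin k) : i.val + 1 = l.val ↔ l = ⟨i.val + 1, hi⟩ := by
      rw [Fin.ext_iff]
      exact eq_comm
    simp only [h, Finset.sum_ite_eq', Finset.mem_univ, if_true, xiVec]
    grind
  · have h (l : Fin k) : ¬ i.val + 1 = l.val := by omega
    simp only [h, if_false, Finset.sum_const_zero, xiVec]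
    grind

theorem dotProduct_Qmat_mulVec (k : ℕ) (v w : Fin k → ℤ) :
    v ⬝ᵥ (Qmat k *ᵥ w) = -((upperBidiagonal k *ᵥ v) ⬝ᵥ (upperBidiagonal k *ᵥ w)) := by
  rw [Qmat_eq_neg_transpose_mul, neg_mulVec, dotProduct_neg, ← mulVec_mulVec, dotProduct_mulVec,
    vecMul_transpose]

theorem one_dotProduct_modEq_dotProduct_self {ι : Type*} [Fintype ι] (u : ι → ℤ) :
    1 ⬝ᵥ u ≡ u ⬝ᵥ u [ZMOD 2] := by
  rw [Int.modEq_iff_dvd, ← sub_dotProduct]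
  refine Finset.dvd_sum fun i _ => ?_
  rw [Pi.sub_apply, Pi.one_apply, mul_comm]
  exact (Int.even_mul_pred_self (u i)).two_dvd

theorem xiVec_characteristic (k : ℕ) (w : Fin k → ℤ) :
    xiVec k ⬝ᵥ (Qmat k *ᵥ w) ≡ w ⬝ᵥ (Qmat k *ᵥ w) [ZMOD 2] := by
  rw [dotProduct_Qmat_mulVec, dotProduct_Qmat_mulVec, upperBidiagonal_mulVec_xiVec]
  exact (one_dotProduct_modEq_dotProduct_self _).neg

theorem xiVec_dotProduct_Qmat_mulVec_self (k : ℕ) :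
    xiVec k ⬝ᵥ (Qmat k *ᵥ xiVec k) = -(k : ℤ) := by
  rw [dotProduct_Qmat_mulVec, upperBidiagonal_mulVec_xiVec]
  simp

/-- `ξ` is a characteristic vector for `Q_k`, i.e. `ξᵀ Q_k w ≡ wᵀ Q_k w (mod 2)`
for every `w ∈ ℤ^k`, and `ξᵀ Q_k ξ = -k`.  In particular there exists a
characteristic vector `ξ'` for `Q_k` with `ξ'ᵀ Q_k ξ' + k ≥ 0`. -/
theorem stmt4 (k : ℕ) (hk : 1 ≤ k) :
    (∀ w : Fin k → ℤ,
        dotProduct (xiVec k) ((Qmat k).mulVec w) ≡ dotProduct w ((Qmat k).mulVec w) [ZMOD 2])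
    ∧ dotProduct (xiVec k) ((Qmat k).mulVec (xiVec k)) = -(k : ℤ)
    ∧ ∃ ξ' : Fin k → ℤ,
        (∀ w : Fin k → ℤ,
          dotProduct ξ' ((Qmat k).mulVec w) ≡ dotProduct w ((Qmat k).mulVec w) [ZMOD 2])
        ∧ dotProduct ξ' ((Qmat k).mulVec ξ') + (k : ℤ) ≥ 0 := by
  exact ⟨xiVec_characteristic k, xiVec_dotProduct_Qmat_mulVec_self k, xiVec k,
    xiVec_characteristic k, by rw [xiVec_dotProduct_Qmat_mulVec_self]; simp⟩
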